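/- arXiv:1107.3359 — 2 statements merged into one kernel-verified Lean document; each statement's English description precedes it below -/
import Mathlib

section
/- Let 1 ≤ s ≤ r+1 ≤ n with n ≥ 2, p = r − s + 1, S' = K[x_1,…,x_r], S'' = K[x_s,…,x_n], S = K[x_1,…,x_n], and let I ⊂ S' and J ⊂ S'' be monomial ideals. Then sdepth_S(S/(IS ∩ JS)) ≥ min{ sdepth_S(S/IS), sdepth_{S''}(S''/J) + sdepth_{S'}(I) − p } = min{ sdepth_S(S/IS), sdepth_S(S/JS) + sdepth_S(IS) − n }. -/
open MvPolynomial

/-- The `K`-subspace `m·K[Z]` of `S = K[x_0,…,x_{n-1}]`, where `m` is the monomial with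
exponent vector `a` and `Z` is a set of variables: the span of all monomials `m·w`
with `w` a monomial in the variables of `Z`. -/
noncomputable def StanleySpace (K : Type*) [Field K] {n : ℕ} (a : Fin n →₀ ℕ)
    (Z : Finset (Fin n)) : Submodule K (MvPolynomial (Fin n) K) :=
  Submodule.span K
    {p | ∃ c : Fin n →₀ ℕ, c.support ⊆ Z ∧ p = monomial (a + c) (1 : K)}

/-- `I` is a monomial ideal, i.e. an ideal generated by monomials. -/
def IsMonomialIdeal {K : Type*} [Field K] {n : ℕ}
    (I : Ideal (MvPolynomial (Fin n) K)) : Prop :=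
  ∃ G : Set (Fin n →₀ ℕ), I = Ideal.span ((fun a => monomial a (1 : K)) '' G)

/-- The `K`-subspace of `S` spanned by the monomials lying in `I` but not in `J`.
For monomial ideals `J ⊆ I` this is the canonical `K`-vector space representative
of the `ℤⁿ`-graded module `I/J` inside `S`. -/
noncomputable def monomialSpan (K : Type*) [Field K] {n : ℕ}
    (I J : Ideal (MvPolynomial (Fin n) K)) : Submodule K (MvPolynomial (Fin n) K) :=
  Submodule.span K
    {p | ∃ a : Fin n →₀ ℕ, p = monomial a (1 : K) ∧
      monomial a (1 : K) ∈ I ∧ monomial a (1 : K) ∉ J}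

/-- The family `(a i, Z i), i = 1,…,r` is a Stanley decomposition of the module `I/J`
(represented by the span of the monomials of `I \ J`): the Stanley spaces
`(a i)·K[Z i]` are independent and their (direct) sum is all of `I/J`. -/
def IsStanleyDecomp (K : Type*) [Field K] {n r : ℕ}
    (I J : Ideal (MvPolynomial (Fin n) K))
    (a : Fin r → (Fin n →₀ ℕ)) (Z : Fin r → Finset (Fin n)) : Prop :=
  iSupIndep (fun i => StanleySpace K (a i) (Z i)) ∧
    (⨆ i, StanleySpace K (a i) (Z i)) = monomialSpan K I J

/-- The Stanley depth `sdepth_S (I/J)` of the module `I/J`, where `J ⊆ I ⊆ S` are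
monomial ideals: the largest `d` such that there is a Stanley decomposition of `I/J`
all of whose Stanley spaces use at least `d` variables.  (As `ℕ∞`: the Stanley depth
of the zero module, which admits the empty decomposition, is `⊤`.)
`sdepth K I ⊥` is `sdepth_S I` and `sdepth K ⊤ I` is `sdepth_S (S/I)`. -/
noncomputable def sdepth (K : Type*) [Field K] {n : ℕ}
    (I J : Ideal (MvPolynomial (Fin n) K)) : ℕ∞ :=
  sSup {d : ℕ∞ | ∃ (r : ℕ) (a : Fin r → (Fin n →₀ ℕ)) (Z : Fin r → Finset (Fin n)),
    IsStanleyDecomp K I J a Z ∧ ∀ i, d ≤ ((Z i).card : ℕ∞)}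

/-- The depth `depth_S M` of an `S`-module `M` with respect to the maximal graded
ideal `(x_0,…,x_{n-1})`: the supremum of the lengths of `M`-regular sequences
contained in that ideal. -/
noncomputable def gradedDepth (K : Type*) [Field K] (n : ℕ) (M : Type*)
    [AddCommGroup M] [Module (MvPolynomial (Fin n) K) M] : ℕ∞ :=
  sSup {k : ℕ∞ | ∃ rs : List (MvPolynomial (Fin n) K), (rs.length : ℕ∞) = k ∧
    (∀ x ∈ rs, x ∈ Ideal.span (Set.range (X : Fin n → MvPolynomial (Fin n) K))) ∧
    RingTheory.Sequence.IsRegular M rs}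

/-- Extension of an ideal along an inclusion of polynomial rings induced by a map
of variables (`IS`, for `f` injective). -/
noncomputable def extIdeal {K : Type*} [Field K] {m n : ℕ} (f : Fin m → Fin n)
    (I : Ideal (MvPolynomial (Fin m) K)) : Ideal (MvPolynomial (Fin n) K) :=
  Ideal.map (rename f : MvPolynomial (Fin m) K →ₐ[K] MvPolynomial (Fin n) K) I

/-- The inclusion of the variables of `S'' = K[x_{r+1},…,x_n]` into those of
`S = K[x_1,…,x_n]` (variables indexed from `0`). -/
def sndEmbed {n r : ℕ} (h : r ≤ n) : Fin (n - r) → Fin n :=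
  fun i => ⟨r + i.1, by have := i.2; omega⟩

/-- The inclusion of the variables of `S'' = K[x_s,…,x_n]` into those of
`S = K[x_1,…,x_n]` (variables indexed from `0`). -/
def midEmbed {n s : ℕ} (hs : 1 ≤ s) (hsn : s ≤ n) : Fin (n + 1 - s) → Fin n :=
  fun i => ⟨s - 1 + i.1, by have := i.2; omega⟩

/-- The exponent vectors of the monomials of the Stanley space `m·K[Z]`, where `m` is the
monomial with exponent vector `a`. -/
def stanleyBox {n : ℕ} (a : Fin n →₀ ℕ) (Z : Finset (Fin n)) : Set (Fin n →₀ ℕ) :=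
  {x | a ≤ x ∧ ∀ i ∉ Z, x i = a i}

/-- The exponent vectors of the monomials lying in `I` but not in `J`. -/
def exponentSet {K : Type*} [Field K] {n : ℕ} (I J : Ideal (MvPolynomial (Fin n) K)) :
    Set (Fin n →₀ ℕ) :=
  {a | monomial a (1 : K) ∈ I ∧ monomial a (1 : K) ∉ J}

/-- The set `A` of exponent vectors has a finite partition into Stanley boxes, each with at
least `d` free directions. -/
def HasStanleyPartition {n : ℕ} (A : Set (Fin n →₀ ℕ)) (d : ℕ∞) : Prop :=
  ∃ (ι : Type) (_ : Finite ι) (a : ι → (Fin n →₀ ℕ)) (Z : ι → Finset (Fin n)),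
    (∀ i, stanleyBox (a i) (Z i) ⊆ A) ∧ (∀ x ∈ A, ∃! i, x ∈ stanleyBox (a i) (Z i)) ∧
      ∀ i, d ≤ ((Z i).card : ℕ∞)

section Box

variable {n : ℕ}

theorem self_mem_stanleyBox (a : Fin n →₀ ℕ) (Z : Finset (Fin n)) : a ∈ stanleyBox a Z :=
  ⟨le_rfl, fun _ _ => rfl⟩

theorem mem_stanleyBox_iff_exists_add {a x : Fin n →₀ ℕ} {Z : Finset (Fin n)} :
    x ∈ stanleyBox a Z ↔ ∃ c : Fin n →₀ ℕ, c.support ⊆ Z ∧ x = a + c := by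
  constructor
  · rintro ⟨h, hZ⟩
    refine ⟨x - a, fun i hi => ?_, (add_tsub_cancel_of_le h).symm⟩
    by_contra hiZ
    simp [hZ i hiZ] at hi
  · rintro ⟨c, hc, rfl⟩
    refine ⟨le_self_add, fun i hi => ?_⟩
    have : c i = 0 := Finsupp.notMem_support_iff.mp fun h => hi (hc h)
    simp [this]

theorem stanleyBox_inter {a b y : Fin n →₀ ℕ} {Z W : Finset (Fin n)}
    (ha : y ∈ stanleyBox a Z) (hb : y ∈ stanleyBox b W) :
    stanleyBox a Z ∩ stanleyBox b W = stanleyBox (a ⊔ b) (Z ∩ W) := by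
  ext x
  constructor
  · rintro ⟨⟨hax, hxa⟩, hbx, hxb⟩
    refine ⟨sup_le hax hbx, fun i hi => ?_⟩
    have h1 := hax i
    have h2 := hbx i
    rw [Finset.mem_inter, not_and_or] at hi
    rw [Finsupp.sup_apply]
    rcases hi with hi | hi
    · have := hxa i hi
      omega
    · have := hxb i hi
      omega
  · rintro ⟨hx, hxi⟩
    refine ⟨⟨le_sup_left.trans hx, fun i hi => ?_⟩, le_sup_right.trans hx, fun i hi => ?_⟩
    · have h1 := hxi i (fun h => hi (Finset.mem_inter.mp h).1)
      have h2 := ha.2 i hi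
      have h3 := hb.1 i
      rw [Finsupp.sup_apply] at h1
      omega
    · have h1 := hxi i (fun h => hi (Finset.mem_inter.mp h).2)
      have h2 := hb.2 i hi
      have h3 := ha.1 i
      rw [Finsupp.sup_apply] at h1
      omega

end Box

namespace HasStanleyPartition

variable {n : ℕ} {A B : Set (Fin n →₀ ℕ)} {d e : ℕ∞}

theorem mono (h : HasStanleyPartition A d) (hed : e ≤ d) : HasStanleyPartition A e := by
  obtain ⟨ι, hι, a, Z, h1, h2, h3⟩ := h
  exact ⟨ι, hι, a, Z, h1, h2, fun i => hed.trans (h3 i)⟩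

theorem union (hA : HasStanleyPartition A d) (hB : HasStanleyPartition B d)
    (hAB : Disjoint A B) : HasStanleyPartition (A ∪ B) d := by
  obtain ⟨ι, _, a, Z, hA1, hA2, hA3⟩ := hA
  obtain ⟨κ, _, b, W, hB1, hB2, hB3⟩ := hB
  refine ⟨ι ⊕ κ, inferInstance, Sum.elim a b, Sum.elim Z W, ?_, ?_, ?_⟩
  · rintro (i | i)
    · exact (hA1 i).trans Set.subset_union_left
    · exact (hB1 i).trans Set.subset_union_right
  · rintro x (hx | hx)
    · obtain ⟨i, hi, hu⟩ := hA2 x hx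
      refine ⟨Sum.inl i, hi, ?_⟩
      rintro (j | j) hj
      · rw [hu j hj]
      · exact (Set.disjoint_left.mp hAB hx (hB1 j hj)).elim
    · obtain ⟨i, hi, hu⟩ := hB2 x hx
      refine ⟨Sum.inr i, hi, ?_⟩
      rintro (j | j) hj
      · exact (Set.disjoint_left.mp hAB (hA1 j hj) hx).elim
      · rw [hu j hj]
  · rintro (i | i)
    · exact hA3 i
    · exact hB3 i

theorem inter (hA : HasStanleyPartition A d) (hB : HasStanleyPartition B e) :
    HasStanleyPartition (A ∩ B) (d + e - n) := by
  obtain ⟨ι, _, a, Z, hA1, hA2, hA3⟩ := hA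
  obtain ⟨κ, _, b, W, hB1, hB2, hB3⟩ := hB
  have key (p : {p : ι × κ //
      (stanleyBox (a p.1) (Z p.1) ∩ stanleyBox (b p.2) (W p.2)).Nonempty}) :
      stanleyBox (a p.1.1) (Z p.1.1) ∩ stanleyBox (b p.1.2) (W p.1.2) =
        stanleyBox (a p.1.1 ⊔ b p.1.2) (Z p.1.1 ∩ W p.1.2) := by
    obtain ⟨y, hy1, hy2⟩ := p.2
    exact stanleyBox_inter hy1 hy2
  refine ⟨{p : ι × κ // (stanleyBox (a p.1) (Z p.1) ∩ stanleyBox (b p.2) (W p.2)).Nonempty},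
    inferInstance, fun p => a p.1.1 ⊔ b p.1.2, fun p => Z p.1.1 ∩ W p.1.2, ?_, ?_, ?_⟩
  · intro p
    rw [← key p]
    exact Set.inter_subset_inter (hA1 _) (hB1 _)
  · rintro x ⟨hxA, hxB⟩
    obtain ⟨i, hi, hiu⟩ := hA2 x hxA
    obtain ⟨j, hj, hju⟩ := hB2 x hxB
    refine ⟨⟨(i, j), x, hi, hj⟩, ?_, ?_⟩
    · change x ∈ stanleyBox (a i ⊔ b j) (Z i ∩ W j)
      rw [← stanleyBox_inter hi hj]
      exact ⟨hi, hj⟩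
    · intro p hp
      rw [← key p] at hp
      exact Subtype.ext (Prod.ext (hiu _ hp.1) (hju _ hp.2))
  · intro p
    have h1 := Finset.card_union_add_card_inter (Z p.1.1) (W p.1.2)
    have h2 := Finset.card_le_univ (Z p.1.1 ∪ W p.1.2)
    rw [Fintype.card_fin] at h2
    rw [tsub_le_iff_right]
    calc d + e ≤ (Z p.1.1).card + (W p.1.2).card := add_le_add (hA3 _) (hB3 _)
      _ ≤ ((Z p.1.1 ∩ W p.1.2).card : ℕ∞) + n := by
        norm_cast
        omega

theorem of_forall_inf_mem_iff {g : Fin n →₀ ℕ} (hg : ∀ x, x ∈ A ↔ x ⊓ g ∈ A) :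
    HasStanleyPartition A 0 := by
  have key (c : Fin n →₀ ℕ) (hc : c ≤ g) (x : Fin n →₀ ℕ) :
      x ∈ stanleyBox c {i | c i = g i} ↔ x ⊓ g = c := by
    constructor
    · rintro ⟨hcx, hxc⟩
      ext i
      have h1 := hcx i
      have h2 := hc i
      have h3 := hxc i
      simp only [Finset.mem_filter_univ] at h3
      rw [Finsupp.inf_apply]
      by_cases h : c i = g i
      · omega
      · have := h3 h
        omega
    · rintro rfl
      refine ⟨inf_le_left, fun i hi => ?_⟩
      have hi' : (x ⊓ g) i ≠ g i := fun h => hi (Finset.mem_filter.mpr ⟨Finset.mem_univ _, h⟩)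
      rw [Finsupp.inf_apply] at hi' ⊢
      omega
  have : Finite {c // c ∈ Set.Icc 0 g ∧ c ∈ A} :=
    ((Set.finite_Icc 0 g).subset fun c hc => hc.1 : {c | c ∈ Set.Icc 0 g ∧ c ∈ A}.Finite)
  refine ⟨{c // c ∈ Set.Icc 0 g ∧ c ∈ A}, this, fun c => c.1,
    fun c => {i | c.1 i = g i}, ?_, ?_, fun _ => zero_le⟩
  · intro c x hx
    rw [key c.1 c.2.1.2] at hx
    rw [hg, hx]
    exact c.2.2
  · intro x hx
    refine ⟨⟨x ⊓ g, ⟨zero_le, inf_le_right⟩, (hg x).mp hx⟩, (key _ inf_le_right x).mpr rfl, ?_⟩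
    intro c hc
    exact Subtype.ext ((key c.1 c.2.1.2 x).mp hc).symm

theorem comapDomain_preimage {m : ℕ} {f : Fin m → Fin n} (hf : Function.Injective f)
    {C : Set (Fin m →₀ ℕ)} (hC : HasStanleyPartition C d) :
    HasStanleyPartition {x : Fin n →₀ ℕ | x.comapDomain f hf.injOn ∈ C}
      (d + (n - m : ℕ)) := by
  obtain ⟨ι, hι, a, Z, h1, h2, h3⟩ := hC
  have key (i : ι) (x : Fin n →₀ ℕ) :
      x ∈ stanleyBox ((a i).mapDomain f) ((Z i).map ⟨f, hf⟩ ∪ (Finset.univ.map ⟨f, hf⟩)ᶜ) ↔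
        x.comapDomain f hf.injOn ∈ stanleyBox (a i) (Z i) := by
    constructor
    · rintro ⟨hx, hxi⟩
      refine ⟨fun j => ?_, fun j hj => ?_⟩
      · simpa [Finsupp.mapDomain_apply hf] using hx (f j)
      · have := hxi (f j) (by simpa [hf.eq_iff] using hj)
        simpa [Finsupp.mapDomain_apply hf] using this
    · rintro ⟨hx, hxi⟩
      refine ⟨fun j => ?_, fun j hj => ?_⟩
      · by_cases hj : j ∈ Set.range f
        · obtain ⟨k, rfl⟩ := hj
          simpa [Finsupp.mapDomain_apply hf] using hx k
        · simp [Finsupp.mapDomain_of_notMem_range _ _ hj]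
      · have hj' : j ∈ Finset.univ.map ⟨f, hf⟩ := by
          by_contra h
          exact hj (Finset.mem_union_right _ (Finset.mem_compl.mpr h))
        obtain ⟨k, -, rfl⟩ := Finset.mem_map.mp hj'
        have := hxi k fun hk => hj (Finset.mem_union_left _ (Finset.mem_map_of_mem _ hk))
        simpa [Finsupp.mapDomain_apply hf] using this
  refine ⟨ι, hι, fun i => (a i).mapDomain f,
    fun i => (Z i).map ⟨f, hf⟩ ∪ (Finset.univ.map ⟨f, hf⟩)ᶜ, ?_, ?_, ?_⟩
  · exact fun i x hx => h1 i ((key i x).mp hx)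
  · intro x hx
    simpa only [key] using h2 _ hx
  · intro i
    rw [Finset.card_union_of_disjoint, Finset.card_map, Finset.card_compl, Finset.card_map,
      Finset.card_univ, Fintype.card_fin, Fintype.card_fin, Nat.cast_add]
    · gcongr
      exact h3 i
    · exact disjoint_compl_right_iff.mpr (Finset.map_subset_map.mpr (Finset.subset_univ _))

theorem of_comapDomain_preimage {m : ℕ} {f : Fin m → Fin n} (hf : Function.Injective f)
    {C : Set (Fin m →₀ ℕ)}
    (hC : HasStanleyPartition {x : Fin n →₀ ℕ | x.comapDomain f hf.injOn ∈ C} d) :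
    HasStanleyPartition C (d - (n - m : ℕ)) := by
  obtain ⟨ι, hι, a, Z, h1, h2, h3⟩ := hC
  have key (i : {i : ι // ((a i).comapDomain f hf.injOn).mapDomain f = a i}) (x : Fin m →₀ ℕ) :
      x ∈ stanleyBox ((a i).comapDomain f hf.injOn) ((Z i).preimage f hf.injOn) ↔
        x.mapDomain f ∈ stanleyBox (a i) (Z i) := by
    constructor
    · rintro ⟨hx, hxi⟩
      rw [← i.2]
      refine ⟨Finsupp.mapDomain_mono hx, fun j hj => ?_⟩
      by_cases hjf : j ∈ Set.range f
      · obtain ⟨k, rfl⟩ := hjf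
        simpa [Finsupp.mapDomain_apply hf] using hxi k (by simpa using hj)
      · simp [Finsupp.mapDomain_of_notMem_range _ _ hjf]
    · rintro ⟨hx, hxi⟩
      refine ⟨fun j => ?_, fun j hj => ?_⟩
      · simpa [Finsupp.mapDomain_apply hf] using hx (f j)
      · simpa [Finsupp.mapDomain_apply hf] using hxi (f j) (by simpa using hj)
  have comap_map (x : Fin m →₀ ℕ) : (x.mapDomain f).comapDomain f hf.injOn = x := by
    ext j
    simp [Finsupp.mapDomain_apply hf]
  refine ⟨_, inferInstance, fun i : {i : ι // ((a i).comapDomain f hf.injOn).mapDomain f = a i} =>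
    (a i).comapDomain f hf.injOn, fun i => (Z i).preimage f hf.injOn, ?_, ?_, ?_⟩
  · intro i x hx
    have := h1 i ((key i x).mp hx)
    rwa [Set.mem_ofPred_eq, comap_map] at this
  · intro x hx
    obtain ⟨i, hi, hu⟩ := h2 (x.mapDomain f) (by rwa [Set.mem_ofPred_eq, comap_map])
    have hai : ((a i).comapDomain f hf.injOn).mapDomain f = a i := by
      ext j
      by_cases hjf : j ∈ Set.range f
      · obtain ⟨k, rfl⟩ := hjf
        simp [Finsupp.mapDomain_apply hf]
      · have := hi.1 j
        rw [Finsupp.mapDomain_of_notMem_range _ _ hjf] at this ⊢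
        omega
    exact ⟨⟨i, hai⟩, (key ⟨i, hai⟩ x).mpr hi, fun j hj => Subtype.ext (hu j ((key j x).mp hj))⟩
  · intro i
    rw [tsub_le_iff_right]
    refine (h3 i).trans ?_
    have hsub : Z i ⊆ ((Z i).preimage f hf.injOn).map ⟨f, hf⟩ ∪ (Finset.univ.map ⟨f, hf⟩)ᶜ := by
      intro j hj
      by_cases hjf : j ∈ Finset.univ.map ⟨f, hf⟩
      · obtain ⟨k, -, rfl⟩ := Finset.mem_map.mp hjf
        exact Finset.mem_union_left _ (Finset.mem_map_of_mem _ (Finset.mem_preimage.mpr hj))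
      · exact Finset.mem_union_right _ (Finset.mem_compl.mpr hjf)
    have := (Finset.card_le_card hsub).trans (Finset.card_union_le _ _)
    rw [Finset.card_map, Finset.card_compl, Finset.card_map, Finset.card_univ, Fintype.card_fin,
      Fintype.card_fin] at this
    exact_mod_cast this

end HasStanleyPartition

section StanleyDecomp

variable {K : Type*} [Field K] {n : ℕ}

theorem stanleySpace_eq_restrictSupport (a : Fin n →₀ ℕ) (Z : Finset (Fin n)) :
    StanleySpace K a Z = restrictSupport K (stanleyBox a Z) := by
  rw [restrictSupport_eq_span, StanleySpace]
  congr 1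
  ext p
  simp only [Set.mem_ofPred_eq, Set.mem_image, mem_stanleyBox_iff_exists_add]
  constructor
  · rintro ⟨c, hc, rfl⟩
    exact ⟨_, ⟨c, hc, rfl⟩, rfl⟩
  · rintro ⟨_, ⟨c, hc, rfl⟩, rfl⟩
    exact ⟨c, hc, rfl⟩

theorem monomialSpan_eq_restrictSupport (I J : Ideal (MvPolynomial (Fin n) K)) :
    monomialSpan K I J = restrictSupport K (exponentSet I J) := by
  rw [restrictSupport_eq_span, monomialSpan]
  congr 1
  ext p
  simp only [Set.mem_ofPred_eq, Set.mem_image, exponentSet]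
  constructor
  · rintro ⟨a, rfl, h⟩
    exact ⟨a, h, rfl⟩
  · rintro ⟨a, h, rfl⟩
    exact ⟨a, rfl, h⟩

theorem restrictSupport_iUnion {ι : Sort*} (A : ι → Set (Fin n →₀ ℕ)) :
    restrictSupport K (⋃ i, A i) = ⨆ i, restrictSupport K (A i) := by
  simp_rw [restrictSupport_eq_span, Set.image_iUnion, Submodule.span_iUnion]

theorem restrictSupport_injective :
    Function.Injective (restrictSupport K : Set (Fin n →₀ ℕ) → _) := by
  intro A B h
  ext x
  have : monomial x (1 : K) ∈ restrictSupport K A ↔ monomial x (1 : K) ∈ restrictSupport K B := by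
    rw [h]
  simpa [monomial_mem_restrictSupport] using this

theorem disjoint_restrictSupport_iff {A B : Set (Fin n →₀ ℕ)} :
    Disjoint (restrictSupport K A) (restrictSupport K B) ↔ Disjoint A B := by
  constructor
  · intro h
    refine Set.disjoint_left.mpr fun x hA hB => ?_
    have := Submodule.disjoint_def.mp h (monomial x 1)
      ((monomial_mem_restrictSupport K).mpr (Or.inl hA))
      ((monomial_mem_restrictSupport K).mpr (Or.inl hB))
    simp at this
  · intro h
    refine Submodule.disjoint_def.mpr fun p hA hB => ?_
    rw [mem_restrictSupport_iff] at hA hB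
    rw [← support_eq_empty, ← Finset.coe_eq_empty]
    exact Set.subset_eq_empty (Set.subset_inter hA hB) h.inter_eq

theorem iSupIndep_restrictSupport_iff {ι : Type*} {A : ι → Set (Fin n →₀ ℕ)} :
    iSupIndep (fun i => restrictSupport K (A i)) ↔ Pairwise (Function.onFun Disjoint A) := by
  constructor
  · intro h i j hij
    exact disjoint_restrictSupport_iff.mp (h.pairwiseDisjoint hij)
  · intro h i
    simp_rw [← restrictSupport_iUnion]
    rw [disjoint_restrictSupport_iff]
    simpa only [Set.disjoint_iUnion_right] using fun j hj => h hj.symm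

theorem isStanleyDecomp_iff {r : ℕ} {I J : Ideal (MvPolynomial (Fin n) K)}
    {a : Fin r → (Fin n →₀ ℕ)} {Z : Fin r → Finset (Fin n)} :
    IsStanleyDecomp K I J a Z ↔
      (∀ i, stanleyBox (a i) (Z i) ⊆ exponentSet I J) ∧
        ∀ x ∈ exponentSet I J, ∃! i, x ∈ stanleyBox (a i) (Z i) := by
  simp_rw [IsStanleyDecomp, stanleySpace_eq_restrictSupport, monomialSpan_eq_restrictSupport,
    iSupIndep_restrictSupport_iff, ← restrictSupport_iUnion, restrictSupport_injective.eq_iff]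
  constructor
  · rintro ⟨hd, hU⟩
    rw [← hU]
    refine ⟨fun i => Set.subset_iUnion (fun i => stanleyBox (a i) (Z i)) i, fun x hx => ?_⟩
    obtain ⟨i, hi⟩ := Set.mem_iUnion.mp hx
    refine ⟨i, hi, fun j hj => ?_⟩
    by_contra hne
    exact Set.disjoint_left.mp (hd hne) hj hi
  · rintro ⟨h1, h2⟩
    refine ⟨fun i j hij => Set.disjoint_left.mpr fun x hi hj =>
      hij ((h2 x (h1 i hi)).unique hi hj), Set.Subset.antisymm (Set.iUnion_subset h1) ?_⟩
    intro x hx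
    obtain ⟨i, hi, -⟩ := h2 x hx
    exact Set.mem_iUnion.mpr ⟨i, hi⟩

theorem sdepth_eq_sSup (I J : Ideal (MvPolynomial (Fin n) K)) :
    sdepth K I J = sSup {d | HasStanleyPartition (exponentSet I J) d} := by
  rw [sdepth]
  congr 1
  ext d
  simp only [Set.mem_ofPred_eq, isStanleyDecomp_iff]
  constructor
  · rintro ⟨r, a, Z, ⟨h1, h2⟩, h3⟩
    exact ⟨Fin r, inferInstance, a, Z, h1, h2, h3⟩
  · rintro ⟨ι, _, a, Z, h1, h2, h3⟩
    obtain ⟨r, ⟨e⟩⟩ := Finite.exists_equiv_fin ι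
    refine ⟨r, a ∘ e.symm, Z ∘ e.symm, ⟨fun i => h1 _, fun x hx => ?_⟩, fun i => h3 _⟩
    obtain ⟨i, hi, hu⟩ := h2 x hx
    refine ⟨e i, by simpa using hi, fun j hj => ?_⟩
    rw [← hu _ hj, e.apply_symm_apply]

theorem HasStanleyPartition.le_sdepth {I J : Ideal (MvPolynomial (Fin n) K)} {d : ℕ∞}
    (h : HasStanleyPartition (exponentSet I J) d) : d ≤ sdepth K I J := by
  rw [sdepth_eq_sSup]
  exact le_sSup h

theorem HasStanleyPartition.attains_sdepth {I J : Ideal (MvPolynomial (Fin n) K)}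
    (h : HasStanleyPartition (exponentSet I J) 0) :
    HasStanleyPartition (exponentSet I J) (sdepth K I J) := by
  rw [sdepth_eq_sSup]
  set s := {d | HasStanleyPartition (exponentSet I J) d}
  have : Nonempty s := ⟨0, h⟩
  rcases eq_or_ne (sSup s) ⊤ with htop | htop
  · obtain ⟨d, ⟨ι, hι, a, Z, h1, h2, h3⟩, hd⟩ :=
      lt_sSup_iff.mp (htop ▸ ENat.natCast_lt_top n : (n : ℕ∞) < sSup s)
    refine ⟨ι, hι, a, Z, h1, h2, fun i => ?_⟩
    have : (n : ℕ∞) < (Z i).card := hd.trans_le (h3 i)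
    have hle := Finset.card_le_univ (Z i)
    rw [Fintype.card_fin] at hle
    exact absurd hle (not_le.mpr (by exact_mod_cast this))
  · exact ENat.sSup_mem_of_nonempty_of_lt_top (lt_top_iff_ne_top.mpr htop)

end StanleyDecomp

section MonomialIdeal

variable {K : Type*} [Field K] {n m : ℕ}

theorem monomial_mem_span_monomial_iff {G : Set (Fin n →₀ ℕ)} {x : Fin n →₀ ℕ} :
    monomial x (1 : K) ∈ Ideal.span ((fun a => monomial a (1 : K)) '' G) ↔ ∃ g ∈ G, g ≤ x := by
  classical
  simp [mem_ideal_span_monomial_image, support_monomial]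

theorem IsMonomialIdeal.exists_inf_mem_iff {I : Ideal (MvPolynomial (Fin n) K)}
    (hI : IsMonomialIdeal I) :
    ∃ g : Fin n →₀ ℕ, ∀ x, monomial x (1 : K) ∈ I ↔ monomial (x ⊓ g) (1 : K) ∈ I := by
  obtain ⟨G, rfl⟩ := hI
  obtain ⟨T, hTG, hT⟩ := (Submodule.fg_span_iff_fg_span_finset_subset _).mp
    (IsNoetherian.noetherian (Ideal.span ((fun a => monomial a (1 : K)) '' G)))
  obtain ⟨F, -, hFT⟩ := (Set.subset_image_iff).mp hTG
  have hF : F.Finite := by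
    refine Set.Finite.of_finite_image (hFT ▸ T.finite_toSet) ?_
    exact (monomial_left_injective one_ne_zero).injOn
  have hspan : Ideal.span ((fun a => monomial a (1 : K)) '' G) =
      Ideal.span ((fun a => monomial a (1 : K)) '' F) := by
    rw [hFT]
    exact hT
  refine ⟨hF.toFinset.sup id, fun x => ?_⟩
  rw [hspan, monomial_mem_span_monomial_iff, monomial_mem_span_monomial_iff]
  refine exists_congr fun g => and_congr_right fun hg => ?_
  have : g ≤ hF.toFinset.sup id := Finset.le_sup (f := id) (hF.mem_toFinset.mpr hg)
  simp [this]

theorem IsMonomialIdeal.hasStanleyPartition_quot {I : Ideal (MvPolynomial (Fin n) K)}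
    (hI : IsMonomialIdeal I) : HasStanleyPartition (exponentSet ⊤ I) 0 := by
  obtain ⟨g, hg⟩ := hI.exists_inf_mem_iff
  refine .of_forall_inf_mem_iff (g := g) fun x => ?_
  simp [exponentSet, ← hg x]

theorem IsMonomialIdeal.hasStanleyPartition {I : Ideal (MvPolynomial (Fin n) K)}
    (hI : IsMonomialIdeal I) : HasStanleyPartition (exponentSet I ⊥) 0 := by
  obtain ⟨g, hg⟩ := hI.exists_inf_mem_iff
  refine .of_forall_inf_mem_iff (g := g) fun x => ?_
  simp [exponentSet, ← hg x]

theorem extIdeal_span_monomial (f : Fin m → Fin n) (G : Set (Fin m →₀ ℕ)) :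
    extIdeal f (Ideal.span ((fun a => monomial a (1 : K)) '' G)) =
      Ideal.span ((fun a => monomial a (1 : K)) '' (Finsupp.mapDomain f '' G)) := by
  rw [extIdeal, Ideal.map_span, Set.image_image, Set.image_image]
  simp [rename_monomial]

theorem IsMonomialIdeal.extIdeal {I : Ideal (MvPolynomial (Fin m) K)} (hI : IsMonomialIdeal I)
    (f : Fin m → Fin n) : IsMonomialIdeal (extIdeal f I) := by
  obtain ⟨G, rfl⟩ := hI
  exact ⟨_, extIdeal_span_monomial f G⟩

theorem IsMonomialIdeal.monomial_mem_extIdeal_iff {I : Ideal (MvPolynomial (Fin m) K)}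
    (hI : IsMonomialIdeal I) {f : Fin m → Fin n} (hf : Function.Injective f) {x : Fin n →₀ ℕ} :
    monomial x (1 : K) ∈ _root_.extIdeal f I ↔
      monomial (x.comapDomain f hf.injOn) (1 : K) ∈ I := by
  obtain ⟨G, rfl⟩ := hI
  rw [extIdeal_span_monomial, monomial_mem_span_monomial_iff, monomial_mem_span_monomial_iff,
    Set.exists_mem_image]
  refine exists_congr fun g => and_congr_right fun _ => ?_
  constructor
  · intro h j
    simpa [Finsupp.mapDomain_apply hf] using h (f j)
  · intro h j
    by_cases hj : j ∈ Set.range f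
    · obtain ⟨k, rfl⟩ := hj
      simpa [Finsupp.mapDomain_apply hf] using h k
    · simp [Finsupp.mapDomain_of_notMem_range _ _ hj]

theorem sdepth_eq_add_of_exponentSet_eq {I J : Ideal (MvPolynomial (Fin m) K)}
    {I' J' : Ideal (MvPolynomial (Fin n) K)} {f : Fin m → Fin n} (hf : Function.Injective f)
    (h0 : HasStanleyPartition (exponentSet I J) 0)
    (h : exponentSet I' J' = {x | x.comapDomain f hf.injOn ∈ exponentSet I J}) :
    sdepth K I' J' = sdepth K I J + (n - m : ℕ) := by
  have h1 := h0.attains_sdepth.comapDomain_preimage hf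
  rw [← h] at h1
  refine le_antisymm ?_ h1.le_sdepth
  have h2 := (h1.mono (zero_le)).attains_sdepth
  rw [h] at h2
  exact tsub_le_iff_right.mp (h2.of_comapDomain_preimage hf).le_sdepth

theorem IsMonomialIdeal.sdepth_quot_extIdeal {I : Ideal (MvPolynomial (Fin m) K)}
    (hI : IsMonomialIdeal I) {f : Fin m → Fin n} (hf : Function.Injective f) :
    sdepth K ⊤ (_root_.extIdeal f I) = sdepth K ⊤ I + (n - m : ℕ) := by
  refine sdepth_eq_add_of_exponentSet_eq hf hI.hasStanleyPartition_quot ?_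
  ext x
  simp [exponentSet, hI.monomial_mem_extIdeal_iff hf]

theorem IsMonomialIdeal.sdepth_extIdeal {I : Ideal (MvPolynomial (Fin m) K)}
    (hI : IsMonomialIdeal I) {f : Fin m → Fin n} (hf : Function.Injective f) :
    sdepth K (_root_.extIdeal f I) ⊥ = sdepth K I ⊥ + (n - m : ℕ) := by
  refine sdepth_eq_add_of_exponentSet_eq hf hI.hasStanleyPartition ?_
  ext x
  simp [exponentSet, hI.monomial_mem_extIdeal_iff hf]

theorem IsMonomialIdeal.min_le_sdepth_quot_inf {I J : Ideal (MvPolynomial (Fin n) K)}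
    (hI : IsMonomialIdeal I) (hJ : IsMonomialIdeal J) :
    min (sdepth K ⊤ I) (sdepth K ⊤ J + sdepth K I ⊥ - (n : ℕ∞)) ≤ sdepth K ⊤ (I ⊓ J) := by
  have hU : exponentSet ⊤ (I ⊓ J) = exponentSet ⊤ I ∪ (exponentSet ⊤ J ∩ exponentSet I ⊥) := by
    ext x
    simp [exponentSet]
    tauto
  have hd : Disjoint (exponentSet ⊤ I) (exponentSet ⊤ J ∩ exponentSet I ⊥) :=
    Set.disjoint_left.mpr fun x hx hx' => hx.2 hx'.2.1
  refine HasStanleyPartition.le_sdepth ?_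
  rw [hU]
  exact (hI.hasStanleyPartition_quot.attains_sdepth.mono (min_le_left _ _)).union
    ((hJ.hasStanleyPartition_quot.attains_sdepth.inter
      hI.hasStanleyPartition.attains_sdepth).mono (min_le_right _ _)) hd

end MonomialIdeal

/-- Let `1 ≤ s ≤ r+1 ≤ n`, `n ≥ 2`, `p = r - s + 1`,
`S' = K[x_1,…,x_r]`, `S'' = K[x_s,…,x_n]`, and `I ⊂ S'`, `J ⊂ S''` monomial ideals.
Then `sdepth_S(S/(IS ∩ JS)) ≥ min(sdepth_S(S/IS), sdepth_{S''}(S''/J) + sdepth_{S'}(I) - p)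
= min(sdepth_S(S/IS), sdepth_S(S/JS) + sdepth_S(IS) - n)`. -/
theorem sdepth_quot_inf_general {K : Type*} [Field K] {n r s : ℕ}
    (hs : 1 ≤ s) (hsr : s ≤ r + 1) (hrn : r + 1 ≤ n) (hn : 2 ≤ n)
    (I : Ideal (MvPolynomial (Fin r) K)) (J : Ideal (MvPolynomial (Fin (n + 1 - s)) K))
    (hmI : IsMonomialIdeal I) (hmJ : IsMonomialIdeal J)
    (hI0 : I ≠ ⊥) (hI1 : I ≠ ⊤) (hJ0 : J ≠ ⊥) (hJ1 : J ≠ ⊤) :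
    sdepth K ⊤ (extIdeal (Fin.castLE (by omega : r ≤ n)) I ⊓
        extIdeal (midEmbed hs (by omega : s ≤ n)) J) ≥
      min (sdepth K ⊤ (extIdeal (Fin.castLE (by omega : r ≤ n)) I))
        (sdepth K ⊤ J + sdepth K I ⊥ - ((r + 1 - s : ℕ) : ℕ∞)) ∧
    min (sdepth K ⊤ (extIdeal (Fin.castLE (by omega : r ≤ n)) I))
        (sdepth K ⊤ J + sdepth K I ⊥ - ((r + 1 - s : ℕ) : ℕ∞)) =
      min (sdepth K ⊤ (extIdeal (Fin.castLE (by omega : r ≤ n)) I))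
        (sdepth K ⊤ (extIdeal (midEmbed hs (by omega : s ≤ n)) J) +
          sdepth K (extIdeal (Fin.castLE (by omega : r ≤ n)) I) ⊥ - (n : ℕ∞)) := by
  have hf : Function.Injective (Fin.castLE (by omega : r ≤ n)) := Fin.castLE_injective _
  have hg : Function.Injective (midEmbed hs (by omega : s ≤ n)) := by
    intro i j hij
    simp only [midEmbed, Fin.mk.injEq] at hij
    omega
  have heq : sdepth K ⊤ (extIdeal (midEmbed hs (by omega : s ≤ n)) J) +
      sdepth K (extIdeal (Fin.castLE (by omega : r ≤ n)) I) ⊥ - (n : ℕ∞) =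
        sdepth K ⊤ J + sdepth K I ⊥ - ((r + 1 - s : ℕ) : ℕ∞) := by
    rw [hmJ.sdepth_quot_extIdeal hg, hmI.sdepth_extIdeal hf, add_add_add_comm, ← Nat.cast_add]
    have hn' : (n : ℕ∞) = (r + 1 - s : ℕ) + (n - (n + 1 - s) + (n - r) : ℕ) := by
      rw [← Nat.cast_add]
      congr 1
      omega
    rw [hn', add_comm ((r + 1 - s : ℕ) : ℕ∞), tsub_add_eq_tsub_tsub,
      (ENat.addLECancellable_natCast _).add_tsub_cancel_right]
  rw [heq]
  refine ⟨?_, rfl⟩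
  rw [← heq]
  exact (hmI.extIdeal _).min_le_sdepth_quot_inf (hmJ.extIdeal _)
end

section
/- If I ⊂ S = K[x_1,…,x_n] is a monomial ideal and u ∈ S is a monomial, then sdepth_S(S/(I : u)) ≥ sdepth_S(S/I), where (I : u) = { f ∈ S : uf ∈ I }. -/
open MvPolynomial

/-- The exponent vectors of the monomials in the Stanley space `m·K[Z]`. -/
def stanleyBlock {n : ℕ} (a : Fin n →₀ ℕ) (Z : Finset (Fin n)) : Set (Fin n →₀ ℕ) :=
  {m | a ≤ m ∧ ∀ j ∉ Z, m j = a j}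

/-- A set of exponent vectors is determined by the span of its monomials. -/
lemma monomial_mem_span_image_iff (K : Type*) [Field K] {n : ℕ} {A : Set (Fin n →₀ ℕ)}
    {m : Fin n →₀ ℕ} :
    monomial m (1 : K) ∈ Submodule.span K ((fun a => monomial a (1 : K)) '' A) ↔ m ∈ A := by
  have hli := (basisMonomials (Fin n) K).linearIndependent
  rw [coe_basisMonomials] at hli
  refine ⟨fun h => ?_, fun h => Submodule.subset_span ⟨m, h, rfl⟩⟩
  by_contra hm
  exact hli.notMem_span_image hm h

lemma stanleySpace_eq_span_image (K : Type*) [Field K] {n : ℕ} (a : Fin n →₀ ℕ)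
    (Z : Finset (Fin n)) :
    StanleySpace K a Z =
      Submodule.span K ((fun m => monomial m (1 : K)) '' stanleyBlock a Z) := by
  unfold StanleySpace
  congr 1
  ext p
  constructor
  · rintro ⟨c, hc, rfl⟩
    refine ⟨a + c, ⟨le_self_add, fun j hj => ?_⟩, rfl⟩
    have : c j = 0 := Finsupp.notMem_support_iff.1 fun h => hj (hc h)
    simp [this]
  · rintro ⟨m, ⟨ham, hm⟩, rfl⟩
    refine ⟨m - a, fun j hj => ?_, by rw [add_tsub_cancel_of_le ham]⟩
    by_contra hjZ
    simp [hm j hjZ] at hj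

/-- A Stanley decomposition of `S/J` is a partition of the monomials outside `J` into blocks. -/
lemma isStanleyDecomp_top_iff (K : Type*) [Field K] {n r : ℕ}
    (J : Ideal (MvPolynomial (Fin n) K)) (a : Fin r → (Fin n →₀ ℕ))
    (Z : Fin r → Finset (Fin n)) :
    IsStanleyDecomp K ⊤ J a Z ↔
      Pairwise (Function.onFun Disjoint fun i => stanleyBlock (a i) (Z i)) ∧
        ∀ m, (∃ i, m ∈ stanleyBlock (a i) (Z i)) ↔ monomial m (1 : K) ∉ J := by
  have hli := (basisMonomials (Fin n) K).linearIndependent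
  rw [coe_basisMonomials] at hli
  have hJ : monomialSpan K ⊤ J =
      Submodule.span K ((fun m => monomial m (1 : K)) '' {m | monomial m (1 : K) ∉ J}) := by
    unfold monomialSpan
    congr 1
    ext p
    constructor
    · rintro ⟨m, rfl, -, hm⟩
      exact ⟨m, hm, rfl⟩
    · rintro ⟨m, hm, rfl⟩
      exact ⟨m, rfl, Submodule.mem_top, hm⟩
  unfold IsStanleyDecomp
  simp only [stanleySpace_eq_span_image, hJ]
  refine and_congr ⟨fun h i j hij => ?_, fun h i => ?_⟩ ?_
  · refine Set.disjoint_left.2 fun m hi hj => ?_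
    have h0 := Submodule.disjoint_def.1 (h.pairwiseDisjoint hij) _
      ((monomial_mem_span_image_iff K).2 hi) ((monomial_mem_span_image_iff K).2 hj)
    exact hli.ne_zero m h0
  · simp only [← Submodule.span_iUnion, ← Set.image_iUnion]
    refine hli.disjoint_span_image ?_
    simp only [Set.disjoint_iUnion_right]
    exact fun j hj => h hj.symm
  · simp only [← Submodule.span_iUnion, ← Set.image_iUnion]
    constructor
    · intro h m
      rw [← Set.mem_iUnion, ← monomial_mem_span_image_iff K, h, monomial_mem_span_image_iff K]
      rfl
    · intro h
      congr 2
      ext m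
      rw [Set.mem_iUnion, h]
      rfl

/-- The preimage of a block under translation by `u` is again a block, or empty. -/
lemma add_mem_stanleyBlock_iff {n : ℕ} {a u m : Fin n →₀ ℕ} {Z : Finset (Fin n)} :
    u + m ∈ stanleyBlock a Z ↔ (∀ j ∉ Z, u j ≤ a j) ∧ m ∈ stanleyBlock (a - u) Z := by
  simp only [stanleyBlock, Set.mem_ofPred_eq, Finsupp.le_def, Finsupp.add_apply,
    Finsupp.tsub_apply]
  constructor
  · rintro ⟨h1, h2⟩
    refine ⟨fun j hj => ?_, fun j => ?_, fun j hj => ?_⟩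
    · have := h2 j hj
      omega
    · have := h1 j
      omega
    · have := h2 j hj
      omega
  · rintro ⟨h1, h2, h3⟩
    refine ⟨fun j => ?_, fun j hj => ?_⟩
    · have := h2 j
      omega
    · have := h1 j hj
      have := h3 j hj
      omega

/-- If `I ⊂ S = K[x_1,…,x_n]` is a monomial ideal and `u ∈ S` is a
monomial, then `sdepth_S(S/(I : u)) ≥ sdepth_S(S/I)`. -/
theorem sdepth_quot_colon_ge {K : Type*} [Field K] {n : ℕ}
    (I : Ideal (MvPolynomial (Fin n) K)) (hmI : IsMonomialIdeal I) (hI1 : I ≠ ⊤)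
    (u : Fin n →₀ ℕ) :
    sdepth K ⊤ (I.colon (Ideal.span {MvPolynomial.monomial u (1 : K)})) ≥
      sdepth K ⊤ I := by
  refine sSup_le_sSup ?_
  rintro d ⟨r, a, Z, hdec, hd⟩
  rw [isStanleyDecomp_top_iff] at hdec
  obtain ⟨hdisj, hcov⟩ := hdec
  classical
  let s : Finset (Fin r) := Finset.univ.filter fun i => ∀ j ∉ Z i, u j ≤ a i j
  have hs : ∀ i, i ∈ s ↔ ∀ j ∉ Z i, u j ≤ a i j := fun i => by simp [s]
  let e := s.equivFin.symm
  refine ⟨s.card, fun k => a (e k) - u, fun k => Z (e k), ?_, fun k => hd _⟩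
  have hmem : ∀ k m, m ∈ stanleyBlock (a (e k) - u) (Z (e k)) ↔
      u + m ∈ stanleyBlock (a (e k)) (Z (e k)) := fun k m => by
    rw [add_mem_stanleyBlock_iff, and_iff_right ((hs _).1 (e k).2)]
  rw [isStanleyDecomp_top_iff]
  refine ⟨fun k l hkl => Set.disjoint_left.2 fun m hk hl => ?_, fun m => ?_⟩
  · have hne : (e k : Fin r) ≠ e l := fun h => hkl (e.injective (Subtype.ext h))
    exact Set.disjoint_left.1 (hdisj hne) ((hmem k m).1 hk) ((hmem l m).1 hl)
  · rw [Ideal.mem_colon_span_singleton, monomial_mul, one_mul, add_comm m u, ← hcov]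
    constructor
    · rintro ⟨k, hk⟩
      exact ⟨e k, (hmem k m).1 hk⟩
    · rintro ⟨i, hi⟩
      have his : i ∈ s := (hs i).2 (add_mem_stanleyBlock_iff.1 hi).1
      refine ⟨e.symm ⟨i, his⟩, (hmem _ m).2 ?_⟩
      simpa using hi
end
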